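/- arXiv:2107.11865 — 2 statements merged into one kernel-verified Lean document; each statement's English description precedes it below -/
import Mathlib

section
/- Let m : M⁺(ℝ^d) → M⁺(ℝ^d) have measure-valued linear functional derivative δₘm, and let g : M⁺(ℝ^d) → ℝ be bounded, weakly continuous, with linear functional derivative δg. Then the composition μ ↦ g(m(μ)) is bounded, weakly continuous, and has linear functional derivative δ(g∘m)(μ,x) = ⟨δₘm(μ,x), δg(m(μ),·)⟩ = ∫ δg(m(μ),y) d(δₘm(μ,x))(y) for all μ ∈ M⁺(ℝ^d), x ∈ ℝ^d. -/
open MeasureTheory Set Filter Topology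
open scoped NNReal ENNReal

noncomputable section

/-- `ℝ^d`. -/
abbrev Eu (d : ℕ) : Type := EuclideanSpace ℝ (Fin d)

/-- `M⁺(ℝ^d)`, the finite positive Borel measures on `ℝ^d`, with the weak topology. -/
abbrev Md (d : ℕ) : Type := MeasureTheory.FiniteMeasure (Eu d)

variable {d : ℕ}

/-- The segment `t μ' + (1 - t) μ` in the space of finite measures. -/
noncomputable def seg (μ μ' : Md d) (t : ℝ) : Md d :=
  t.toNNReal • μ' + (1 - t).toNNReal • μ

/-- `⟨μ, ψ⟩ = ∫ ψ dμ`. -/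
noncomputable def pairing (μ : Md d) (ψ : Eu d → ℝ) : ℝ :=
  ∫ x, ψ x ∂(μ : Measure (Eu d))

/-- `δu` is a linear functional derivative of `u : M⁺(ℝ^d) → ℝ`: it is bounded, jointly
continuous (weak topology on measures), and satisfies the fundamental identity. -/
def IsLFD (u : Md d → ℝ) (δu : Md d → Eu d → ℝ) : Prop :=
  (∃ C : ℝ, ∀ (μ : Md d) (x : Eu d), |δu μ x| ≤ C) ∧
  Continuous (fun p : Md d × Eu d => δu p.1 p.2) ∧
  ∀ μ μ' : Md d,
    u μ' - u μ =
      ∫ t in (0:ℝ)..1,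
        (pairing μ' (fun x => δu (seg μ μ' t) x) - pairing μ (fun x => δu (seg μ μ' t) x))

/-- `δm` is a measure-valued linear functional derivative of `m : M⁺(ℝ^d) → M⁺(ℝ^d)`:
bounded in total variation (for positive measures, the total mass), jointly continuous
(weak topology), and satisfying the fundamental identity tested against every bounded
continuous `ψ`. -/
def IsMLFD (m : Md d → Md d) (δm : Md d → Eu d → Md d) : Prop :=
  (∃ C : ℝ≥0, ∀ (μ : Md d) (x : Eu d), (δm μ x).mass ≤ C) ∧
  Continuous (fun p : Md d × Eu d => δm p.1 p.2) ∧
  ∀ (ψ : BoundedContinuousFunction (Eu d) ℝ) (μ μ' : Md d),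
    pairing (m μ') (fun y => ψ y) - pairing (m μ) (fun y => ψ y) =
      ∫ t in (0:ℝ)..1,
        ((∫ x, pairing (δm (seg μ μ' t) x) (fun y => ψ y) ∂(μ' : Measure (Eu d))) -
         (∫ x, pairing (δm (seg μ μ' t) x) (fun y => ψ y) ∂(μ : Measure (Eu d))))

theorem abs_integral_le_mul_mass {f : Eu d → ℝ} {C : ℝ} (hf : ∀ x, |f x| ≤ C) (μ : Md d) :
    |∫ x, f x ∂(μ : Measure (Eu d))| ≤ C * μ.mass := by
  have h := norm_integral_le_of_norm_le_const (μ := (μ : Measure (Eu d))) (f := f) (C := C)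
    (Eventually.of_forall hf)
  exact h

theorem integrable_of_continuous_of_bounded {f : Eu d → ℝ} (hf : Continuous f) {C : ℝ}
    (hC : ∀ x, |f x| ≤ C) (μ : Md d) : Integrable f (μ : Measure (Eu d)) :=
  Integrable.of_bound hf.aestronglyMeasurable C (Eventually.of_forall hC)

theorem continuous_integral_of_bounded {f : Eu d → ℝ} (hf : Continuous f) {C : ℝ}
    (hC : ∀ x, |f x| ≤ C) : Continuous fun μ : Md d => ∫ y, f y ∂(μ : Measure (Eu d)) :=
  continuous_iff_continuousAt.2 fun μ =>
    FiniteMeasure.tendsto_iff_forall_integral_tendsto.1 (tendsto_id (α := Md d) (x := 𝓝 μ))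
      (BoundedContinuousFunction.ofNormedAddCommGroup f hf C hC)

theorem continuous_mass : Continuous fun μ : Md d => (μ.mass : ℝ) :=
  NNReal.continuous_coe.comp FiniteMeasure.continuous_mass

/-- A continuous weight, equal to `1` outside the ball of radius `n + 1`, whose integrals vanish
as `n → ∞`. -/
def tailWeight (n : ℕ) (y : Eu d) : ℝ := min 1 (‖y‖ / (n + 1))

theorem tailWeight_nonneg (n : ℕ) (y : Eu d) : 0 ≤ tailWeight n y := by
  unfold tailWeight; positivity

theorem abs_tailWeight_le (n : ℕ) (y : Eu d) : |tailWeight n y| ≤ 1 := by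
  rw [abs_of_nonneg (tailWeight_nonneg n y)]
  exact min_le_left _ _

theorem continuous_tailWeight (n : ℕ) : Continuous (tailWeight n : Eu d → ℝ) := by
  unfold tailWeight; fun_prop

theorem tendsto_integral_tailWeight (μ : Md d) :
    Tendsto (fun n => ∫ y, tailWeight n y ∂(μ : Measure (Eu d))) atTop (𝓝 0) := by
  have h := tendsto_integral_of_dominated_convergence (μ := (μ : Measure (Eu d)))
    (F := fun n y => tailWeight n y) (f := fun _ => (0 : ℝ)) (fun _ => 1)
    (fun n => (continuous_tailWeight n).aestronglyMeasurable) (integrable_const _)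
    (fun n => Eventually.of_forall (abs_tailWeight_le n))
    (Eventually.of_forall fun y => by
      have h0 : Tendsto (fun n : ℕ => ‖y‖ / ((n : ℝ) + 1)) atTop (𝓝 0) :=
        Tendsto.div_atTop tendsto_const_nhds
          (tendsto_atTop_add_const_right _ _ tendsto_natCast_atTop_atTop)
      simpa [tailWeight] using (tendsto_const_nhds (x := (1 : ℝ))).min h0)
  simpa using h

/-- Integrating a bounded jointly continuous function is jointly continuous in the parameter and
the measure, for an arbitrary parameter space. -/
theorem continuous_integral_param {X : Type*} [TopologicalSpace X] {F : X → Eu d → ℝ}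
    (hF : Continuous fun p : X × Eu d => F p.1 p.2) {C : ℝ} (hC : ∀ x y, |F x y| ≤ C) :
    Continuous fun p : X × Md d => ∫ y, F p.1 y ∂(p.2 : Measure (Eu d)) := by
  rw [continuous_iff_continuousAt]
  rintro ⟨x₀, μ₀⟩
  have hFx (x : X) : Continuous (F x) := hF.comp (by fun_prop : Continuous fun y => (x, y))
  have hC0 : 0 ≤ C := (abs_nonneg _).trans (hC x₀ 0)
  have hfix : Tendsto (fun p : X × Md d => ∫ y, F x₀ y ∂(p.2 : Measure (Eu d))) (𝓝 (x₀, μ₀))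
      (𝓝 (∫ y, F x₀ y ∂(μ₀ : Measure (Eu d)))) :=
    ((continuous_integral_of_bounded (hFx x₀) (hC x₀)).comp continuous_snd).tendsto (x₀, μ₀)
  suffices hdiff : Tendsto (fun p : X × Md d => ∫ y, (F p.1 y - F x₀ y) ∂(p.2 : Measure (Eu d)))
      (𝓝 (x₀, μ₀)) (𝓝 0) by
    have h := hfix.add hdiff
    rw [add_zero] at h
    refine h.congr fun p => ?_
    rw [integral_sub (integrable_of_continuous_of_bounded (hFx _) (hC _) _)
      (integrable_of_continuous_of_bounded (hFx _) (hC _) _)]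
    ring
  rw [Metric.tendsto_nhds]
  intro ε hε
  obtain ⟨n, hn⟩ : ∃ n, 2 * C * ∫ y, tailWeight n y ∂(μ₀ : Measure (Eu d)) < ε / 2 := by
    have h := (tendsto_integral_tailWeight μ₀).const_mul (2 * C)
    rw [mul_zero] at h
    exact (h.eventually (gt_mem_nhds (half_pos hε))).exists
  set M : ℝ := μ₀.mass + 1 with hM
  have hM0 : 0 < M := by positivity
  have htail : ∀ᶠ p : X × Md d in 𝓝 (x₀, μ₀),
      2 * C * ∫ y, tailWeight n y ∂(p.2 : Measure (Eu d)) < ε / 2 :=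
    (((continuous_integral_of_bounded (continuous_tailWeight n)
      (abs_tailWeight_le n)).comp continuous_snd).const_mul (2 * C)).tendsto (x₀, μ₀)
        |>.eventually (gt_mem_nhds hn)
  have hmass : ∀ᶠ p : X × Md d in 𝓝 (x₀, μ₀), (p.2.mass : ℝ) < M :=
    (continuous_mass.comp continuous_snd).tendsto (x₀, μ₀)
      |>.eventually (gt_mem_nhds (lt_add_one _))
  have hunif : ∀ᶠ x in 𝓝 x₀, ∀ y ∈ Metric.closedBall (0 : Eu d) (n + 1),
      |F x y - F x₀ y| < ε / (2 * M) := by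
    refine (isCompact_closedBall _ _).eventually_forall_of_forall_eventually fun y _ => ?_
    have hc : Continuous fun z : X × Eu d => |F z.1 z.2 - F x₀ z.2| :=
      (hF.sub ((hFx x₀).comp continuous_snd)).abs
    refine hc.tendsto (x₀, y) |>.eventually (gt_mem_nhds ?_)
    simp only [sub_self, abs_zero]
    positivity
  filter_upwards [htail, hmass, continuous_fst.tendsto (x₀, μ₀) |>.eventually hunif]
    with p hp₁ hp₂ hp₃
  rw [dist_zero_right]
  have hbound (y : Eu d) : ‖F p.1 y - F x₀ y‖ ≤ ε / (2 * M) + 2 * C * tailWeight n y := by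
    by_cases hy : y ∈ Metric.closedBall (0 : Eu d) (n + 1)
    · have := tailWeight_nonneg n y
      exact (hp₃ y hy).le.trans (le_add_of_nonneg_right (by positivity))
    · have hw : tailWeight n y = 1 := by
        rw [mem_closedBall_zero_iff, not_le] at hy
        exact min_eq_left ((one_le_div (by positivity)).2 hy.le)
      rw [hw, mul_one]
      have h₁ : ‖F p.1 y - F x₀ y‖ ≤ C + C :=
        (norm_sub_le _ _).trans (add_le_add (hC _ _) (hC _ _))
      have h₂ : 0 < ε / (2 * M) := by positivity
      linarith
  have hint := integrable_of_continuous_of_bounded (continuous_tailWeight n)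
    (abs_tailWeight_le n) p.2
  have h := norm_integral_le_of_norm_le ((integrable_const _).add (hint.const_mul (2 * C)))
    (Eventually.of_forall hbound)
  simp only [Pi.add_apply] at h
  rw [integral_add (integrable_const _) (hint.const_mul _), integral_const_mul,
    integral_const, smul_eq_mul] at h
  have hreal : (p.2 : Measure (Eu d)).real univ = p.2.mass := rfl
  rw [hreal] at h
  have hlt : (p.2.mass : ℝ) * (ε / (2 * M)) ≤ M * (ε / (2 * M)) := by gcongr
  have hM' : M * (ε / (2 * M)) = ε / 2 := by field_simp
  linarith

theorem continuous_seg : Continuous fun p : Md d × Md d × ℝ => seg p.1 p.2.1 p.2.2 := by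
  unfold seg; fun_prop

theorem seg_self (μ : Md d) {t : ℝ} (ht : t ∈ Icc (0 : ℝ) 1) : seg μ μ t = μ := by
  unfold seg
  rw [← add_smul, ← Real.toNNReal_add ht.1 (by linarith [ht.2])]
  simp

theorem seg_zero (μ μ' : Md d) : seg μ μ' 0 = μ := by simp [seg]

theorem seg_one (μ μ' : Md d) : seg μ μ' 1 = μ' := by simp [seg]

theorem integral_seg {f : Eu d → ℝ} (hf : Continuous f) {C : ℝ} (hC : ∀ x, |f x| ≤ C)
    (μ μ' : Md d) {t : ℝ} (ht : t ∈ Icc (0 : ℝ) 1) :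
    ∫ x, f x ∂(seg μ μ' t : Measure (Eu d)) =
      t * ∫ x, f x ∂(μ' : Measure (Eu d)) + (1 - t) * ∫ x, f x ∂(μ : Measure (Eu d)) := by
  have hi := integrable_of_continuous_of_bounded hf hC
  have hmeas : (seg μ μ' t : Measure (Eu d)) =
      t.toNNReal • (μ' : Measure (Eu d)) + (1 - t).toNNReal • (μ : Measure (Eu d)) := rfl
  rw [hmeas, integral_add_measure ((hi μ').smul_measure_nnreal) ((hi μ).smul_measure_nnreal),
    integral_smul_nnreal_measure, integral_smul_nnreal_measure, NNReal.smul_def, NNReal.smul_def,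
    Real.coe_toNNReal _ ht.1, Real.coe_toNNReal _ (by linarith [ht.2]), smul_eq_mul, smul_eq_mul]

/-- A map with a measure-valued linear functional derivative is weakly continuous. -/
theorem IsMLFD.continuous {m : Md d → Md d} {δm : Md d → Eu d → Md d} (hm : IsMLFD m δm) :
    Continuous m := by
  obtain ⟨⟨C, hC⟩, hc, hid⟩ := hm
  rw [continuous_iff_continuousAt]
  refine fun μ => FiniteMeasure.tendsto_iff_forall_integral_tendsto.2 fun ψ => ?_
  have hF : Continuous fun p : Md d × Eu d => pairing (δm p.1 p.2) (fun y => ψ y) :=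
    (continuous_integral_of_bounded ψ.continuous ψ.norm_coe_le_norm).comp hc
  have hFb (ν : Md d) (x : Eu d) : |pairing (δm ν x) (fun y => ψ y)| ≤ ‖ψ‖ * C :=
    (abs_integral_le_mul_mass ψ.norm_coe_le_norm _).trans
      (mul_le_mul_of_nonneg_left (NNReal.coe_le_coe.2 (hC ν x)) (norm_nonneg _))
  have hP := continuous_integral_param hF hFb
  have hG : Continuous fun μ' : Md d => ∫ t in (0 : ℝ)..1,
      ((∫ x, pairing (δm (seg μ μ' t) x) (fun y => ψ y) ∂(μ' : Measure (Eu d))) -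
        (∫ x, pairing (δm (seg μ μ' t) x) (fun y => ψ y) ∂(μ : Measure (Eu d)))) := by
    refine intervalIntegral.continuous_parametric_intervalIntegral_of_continuous' ?_ 0 1
    have hs : Continuous fun p : Md d × ℝ => seg μ p.1 p.2 :=
      continuous_seg.comp (continuous_const.prodMk continuous_id)
    exact (hP.comp (hs.prodMk continuous_fst)).sub (hP.comp (hs.prodMk continuous_const))
  have h := (hG.add (continuous_const (y := pairing (m μ) fun y => ψ y))).tendsto μ
  simp only [← hid] at h
  simpa [pairing, Pi.add_def] using h

theorem continuous_pairing_derivative {m : Md d → Md d} {δm : Md d → Eu d → Md d}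
    (hm : IsMLFD m δm) {f : Md d → Eu d → ℝ}
    (hf : Continuous fun p : Md d × Eu d => f p.1 p.2) {C : ℝ} (hC : ∀ ν y, |f ν y| ≤ C) :
    Continuous fun p : (Md d × Md d) × Eu d =>
      ∫ y, f p.1.1 y ∂(δm p.1.2 p.2 : Measure (Eu d)) :=
  (continuous_integral_param hf hC).comp
    ((by fun_prop : Continuous fun p : (Md d × Md d) × Eu d => p.1.1).prodMk
      (hm.2.1.comp (by fun_prop : Continuous fun p : (Md d × Md d) × Eu d => (p.1.2, p.2))))

theorem IsMLFD.exists_abs_integral_le {m : Md d → Md d} {δm : Md d → Eu d → Md d}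
    (hm : IsMLFD m δm) {f : Md d → Eu d → ℝ} {C : ℝ} (hC : ∀ ν y, |f ν y| ≤ C) :
    ∃ K : ℝ, ∀ ν κ x, |∫ y, f ν y ∂(δm κ x : Measure (Eu d))| ≤ K := by
  obtain ⟨M, hM⟩ := hm.1
  refine ⟨C * M, fun ν κ x => (abs_integral_le_mul_mass (hC ν) _).trans ?_⟩
  exact mul_le_mul_of_nonneg_left (NNReal.coe_le_coe.2 (hM κ x)) ((abs_nonneg _).trans (hC ν x))

theorem integral_seg_sub {f : Eu d → ℝ} (hf : Continuous f) {C : ℝ} (hC : ∀ x, |f x| ≤ C)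
    (μ μ' : Md d) {s t : ℝ} (hs : s ∈ Icc (0 : ℝ) 1) (ht : t ∈ Icc (0 : ℝ) 1) :
    ∫ x, f x ∂(seg μ μ' t : Measure (Eu d)) - ∫ x, f x ∂(seg μ μ' s : Measure (Eu d)) =
      (t - s) * (∫ x, f x ∂(μ' : Measure (Eu d)) - ∫ x, f x ∂(μ : Measure (Eu d))) := by
  rw [integral_seg hf hC μ μ' hs, integral_seg hf hC μ μ' ht]
  ring

/-- A function whose increments on `[0, 1]` are `(t - s) * Φ (s, t)` with `Φ` continuous is the
integral of `s ↦ Φ (s, s)`. -/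
theorem integral_diag_eq_sub {h : ℝ → ℝ} {Φ : ℝ × ℝ → ℝ} (hΦ : Continuous Φ)
    (hinc : ∀ s ∈ Icc (0 : ℝ) 1, ∀ t ∈ Icc (0 : ℝ) 1, h t - h s = (t - s) * Φ (s, t)) :
    ∫ s in (0 : ℝ)..1, Φ (s, s) = h 1 - h 0 := by
  have hdiag : Continuous fun s => Φ (s, s) := hΦ.comp (by fun_prop)
  have hcont : ContinuousOn h (Icc 0 1) := by
    have hc : Continuous fun t : ℝ => h 0 + (t - 0) * Φ (0, t) :=
      continuous_const.add ((continuous_id.sub continuous_const).mul (hΦ.comp (by fun_prop)))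
    refine hc.continuousOn.congr fun t ht => ?_
    linarith [hinc 0 (by simp) t ht]
  refine intervalIntegral.integral_eq_sub_of_hasDerivAt_of_le zero_le_one hcont
    (fun s hs => ?_) (hdiag.intervalIntegrable _ _)
  rw [hasDerivAt_iff_tendsto_slope]
  have hlim : Tendsto (fun t => Φ (s, t)) (𝓝[≠] s) (𝓝 (Φ (s, s))) :=
    ((hΦ.comp (by fun_prop : Continuous fun t => (s, t))).tendsto s).mono_left nhdsWithin_le_nhds
  refine hlim.congr' ?_
  filter_upwards [nhdsWithin_le_nhds (Icc_mem_nhds hs.1 hs.2), self_mem_nhdsWithin] with t ht hne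
  have hts : t - s ≠ 0 := sub_ne_zero.2 hne
  rw [slope_def_field, hinc s (Ioo_subset_Icc_self hs) t ht]
  field_simp

/-- chain rule for the composition of a real-valued function with a
measure-valued function. If `m` has measure-valued linear functional derivative `δₘm`
and `g` is bounded, weakly continuous with linear functional derivative `δg`, then
`μ ↦ g(m(μ))` is bounded, weakly continuous with linear functional derivative
`(μ,x) ↦ ⟨δₘm(μ,x), δg(m(μ),·)⟩`. -/
theorem stmt4 (m : Md d → Md d) (δm : Md d → Eu d → Md d) (hm : IsMLFD m δm)
    (g : Md d → ℝ) (δg : Md d → Eu d → ℝ)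
    (hgb : ∃ C : ℝ, ∀ μ : Md d, |g μ| ≤ C) (hgc : Continuous g) (hg : IsLFD g δg) :
    (∃ C : ℝ, ∀ μ : Md d, |g (m μ)| ≤ C) ∧
    Continuous (fun μ : Md d => g (m μ)) ∧
    IsLFD (fun μ : Md d => g (m μ))
      (fun μ x => ∫ y, δg (m μ) y ∂(δm μ x : Measure (Eu d))) := by
  obtain ⟨C, hC⟩ := hgb
  obtain ⟨⟨D, hD⟩, hδg, hgid⟩ := hg
  have hmc := hm.continuous
  obtain ⟨K, hK⟩ := hm.exists_abs_integral_le hD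
  have hL := continuous_pairing_derivative hm hδg hD
  refine ⟨⟨C, fun μ => hC _⟩, hgc.comp hmc, ⟨K, fun μ x => hK _ _ _⟩,
    hL.comp (((hmc.comp continuous_fst).prodMk continuous_fst).prodMk continuous_snd),
    fun μ μ' => ?_⟩
  have hP := continuous_integral_param hL fun (p : Md d × Md d) x => hK p.1 p.2 x
  have hseg : Continuous (seg μ μ') :=
    continuous_seg.comp (continuous_const.prodMk (continuous_const.prodMk continuous_id))
  let A (s t r q : ℝ) : ℝ :=
    (∫ x, ∫ y, δg (seg (m (seg μ μ' s)) (m (seg μ μ' t)) r) y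
      ∂(δm (seg (seg μ μ' s) (seg μ μ' t) q) x : Measure (Eu d)) ∂(μ' : Measure (Eu d))) -
    ∫ x, ∫ y, δg (seg (m (seg μ μ' s)) (m (seg μ μ' t)) r) y
      ∂(δm (seg (seg μ μ' s) (seg μ μ' t) q) x : Measure (Eu d)) ∂(μ : Measure (Eu d))
  have hA : Continuous fun p : ((ℝ × ℝ) × ℝ) × ℝ => A p.1.1.1 p.1.1.2 p.1.2 p.2 := by
    have h₁ : Continuous fun p : ((ℝ × ℝ) × ℝ) × ℝ => seg μ μ' p.1.1.1 := hseg.comp (by fun_prop)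
    have h₂ : Continuous fun p : ((ℝ × ℝ) × ℝ) × ℝ => seg μ μ' p.1.1.2 := hseg.comp (by fun_prop)
    have h₃ : Continuous fun p : ((ℝ × ℝ) × ℝ) × ℝ =>
        seg (m (seg μ μ' p.1.1.1)) (m (seg μ μ' p.1.1.2)) p.1.2 :=
      continuous_seg.comp ((hmc.comp h₁).prodMk ((hmc.comp h₂).prodMk (by fun_prop)))
    have h₄ : Continuous fun p : ((ℝ × ℝ) × ℝ) × ℝ =>
        seg (seg μ μ' p.1.1.1) (seg μ μ' p.1.1.2) p.2 :=
      continuous_seg.comp (h₁.prodMk (h₂.prodMk (by fun_prop)))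
    exact (hP.comp ((h₃.prodMk h₄).prodMk continuous_const)).sub
      (hP.comp ((h₃.prodMk h₄).prodMk continuous_const))
  let Φ (p : ℝ × ℝ) : ℝ := ∫ r in (0 : ℝ)..1, ∫ q in (0 : ℝ)..1, A p.1 p.2 r q
  have hΦ : Continuous Φ :=
    intervalIntegral.continuous_parametric_intervalIntegral_of_continuous'
      (f := fun (p : ℝ × ℝ) r => ∫ q in (0 : ℝ)..1, A p.1 p.2 r q)
      (intervalIntegral.continuous_parametric_intervalIntegral_of_continuous'
        (f := fun (p : (ℝ × ℝ) × ℝ) q => A p.1.1 p.1.2 p.2 q) hA 0 1) 0 1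
  have hinc : ∀ s ∈ Icc (0 : ℝ) 1, ∀ t ∈ Icc (0 : ℝ) 1,
      g (m (seg μ μ' t)) - g (m (seg μ μ' s)) = (t - s) * Φ (s, t) := by
    intro s hs t ht
    rw [hgid, ← intervalIntegral.integral_const_mul]
    refine intervalIntegral.integral_congr fun r _ => ?_
    dsimp only
    have hψ : Continuous (δg (seg (m (seg μ μ' s)) (m (seg μ μ' t)) r)) :=
      hδg.comp (continuous_const.prodMk continuous_id)
    refine (hm.2.2 (BoundedContinuousFunction.ofNormedAddCommGroup _ hψ D (hD _)) _ _).trans ?_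
    rw [← intervalIntegral.integral_const_mul]
    refine intervalIntegral.integral_congr fun q _ => ?_
    have hLx (ν κ : Md d) : Continuous fun x => ∫ y, δg ν y ∂(δm κ x : Measure (Eu d)) :=
      hL.comp (by fun_prop : Continuous fun x : Eu d => ((ν, κ), x))
    exact integral_seg_sub (hLx _ _) (hK _ _) μ μ' hs ht
  have h := integral_diag_eq_sub hΦ hinc
  rw [seg_zero, seg_one] at h
  rw [← h]
  refine intervalIntegral.integral_congr fun s _ => ?_
  have hconst : Φ (s, s) = ∫ _ in (0 : ℝ)..1, ∫ _ in (0 : ℝ)..1, A s s 0 0 := by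
    refine intervalIntegral.integral_congr fun r hr => intervalIntegral.integral_congr fun q hq => ?_
    rw [uIcc_of_le zero_le_one] at hr hq
    have h0 : (0 : ℝ) ∈ Icc (0 : ℝ) 1 := by simp
    simp only [A, seg_self _ hr, seg_self _ hq, seg_self _ h0]
  dsimp only
  rw [hconst]
  simp [A, seg_zero, pairing]

end
end

section
/- Fix N ≥ 1 and k > 1, set K_N := [−N,N]^d and let H := { μ ∈ M⁺(ℝ^d) : supp μ ⊆ K_N and μ(ℝ^d) ∈ [1/k, k] }. Let v : H × K_N → ℝ be bounded and jointly continuous (weak topology on H). Then for every μ ∈ H: μ(ℝ^d)^{−n} ∫_{(ℝ^d)ⁿ} (1/n) Σⱼ₌₁ⁿ v( (μ(ℝ^d)/n) Σᵢ₌₁ⁿ δ_{xᵢ}, xⱼ ) dμ^{⊗n}(x₁,…,xₙ) → μ(ℝ^d)^{−1} ∫ v(μ, x) dμ(x) as n → ∞. -/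
open MeasureTheory Set Filter Topology
open scoped NNReal ENNReal

noncomputable section

variable {d : ℕ}

/-- The Dirac measure at `x` as a finite measure. -/
noncomputable def diracFM (x : Eu d) : Md d := ⟨Measure.dirac x, inferInstance⟩

/-- The compact rectangle `K_N = [−N,N]^d`. -/
def KN (d N : ℕ) : Set (Eu d) := {x : Eu d | ∀ i, |x i| ≤ (N : ℝ)}

/-- `H_N^k = {μ ∈ M⁺(ℝ^d) : supp μ ⊆ K_N, μ(ℝ^d) ∈ [1/k, k]}` (the support condition is
expressed as `μ(K_Nᶜ) = 0`, which is equivalent since `K_N` is closed). -/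
def HNk (d N : ℕ) (k : ℝ) : Set (Md d) :=
  {μ : Md d | (μ : Measure (Eu d)) (KN d N)ᶜ = 0 ∧
    1 / k ≤ (μ.mass : ℝ) ∧ (μ.mass : ℝ) ≤ k}

/-- The scaled empirical measure `(c/n) Σᵢ δ_{xᵢ}`. -/
noncomputable def empM {d : ℕ} (c : ℝ) (n : ℕ) (x : Fin n → Eu d) : Md d :=
  (c / (n : ℝ)).toNNReal • ∑ i : Fin n, diracFM (x i)

open ProbabilityTheory TopologicalSpace

section LawOfLargeNumbers

variable {E : Type*} [MeasurableSpace E]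

/-- The strong law of large numbers for the coordinates of an infinite product space, tested
against an integrable function. -/
lemma ae_tendsto_average_infinitePi (P : Measure E) [IsProbabilityMeasure P] {f : E → ℝ}
    (hf : Integrable f P) :
    ∀ᵐ ω ∂(Measure.infinitePi fun _ : ℕ => P),
      Tendsto (fun n : ℕ => (∑ i ∈ Finset.range n, f (ω i)) / n) atTop (𝓝 (∫ x, f x ∂P)) := by
  obtain ⟨g, hg, hfg⟩ := hf.1
  have hgP : Integrable g P := hf.congr hfg
  have heval : ∀ i : ℕ, MeasurePreserving (Function.eval i)
      (Measure.infinitePi fun _ : ℕ => P) P :=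
    fun i => measurePreserving_eval_infinitePi (fun _ : ℕ => P) i
  have hind : iIndepFun (fun (i : ℕ) (ω : ℕ → E) => g (ω i))
      (Measure.infinitePi fun _ : ℕ => P) :=
    iIndepFun_infinitePi (X := fun _ => g) fun _ => hg.measurable
  have hlaw := strong_law_ae_real (μ := Measure.infinitePi fun _ : ℕ => P)
    (fun (i : ℕ) (ω : ℕ → E) => g (ω i))
    ((heval 0).integrable_comp_of_integrable hgP)
    (fun i j hij => hind.indepFun hij)
    (fun i => by
      have h : IdentDistrib (Function.eval i) (Function.eval 0)
          (Measure.infinitePi fun _ : ℕ => P) (Measure.infinitePi fun _ : ℕ => P) :=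
        ⟨(heval i).measurable.aemeasurable, (heval 0).measurable.aemeasurable,
          by rw [(heval i).map_eq, (heval 0).map_eq]⟩
      exact h.comp hg.measurable)
  have hint : ∫ ω, g (ω 0) ∂(Measure.infinitePi fun _ : ℕ => P) = ∫ x, f x ∂P := by
    have h := integral_map (μ := Measure.infinitePi fun _ : ℕ => P)
      (heval 0).measurable.aemeasurable (f := g) hg.aestronglyMeasurable
    rw [(heval 0).map_eq] at h
    rw [integral_congr_ae hfg, h]
  have hae : ∀ᵐ ω ∂(Measure.infinitePi fun _ : ℕ => P), ∀ i : ℕ, f (ω i) = g (ω i) :=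
    ae_all_iff.2 fun i => (heval i).quasiMeasurePreserving.ae hfg
  filter_upwards [hlaw, hae] with ω h1 h2
  simp_rw [h2]
  rwa [hint] at h1

/-- The empirical probability measure of the first `n + 1` terms of a sequence. -/
def empiricalMeasure (ω : ℕ → E) (n : ℕ) : ProbabilityMeasure E :=
  ⟨((n : ℝ≥0∞) + 1)⁻¹ • ∑ i ∈ Finset.range (n + 1), Measure.dirac (ω i), ⟨by
    simp only [Measure.smul_apply, Measure.finsetSum_apply, measure_univ, Finset.sum_const,
      Finset.card_range, nsmul_eq_mul, mul_one, smul_eq_mul, Nat.cast_add, Nat.cast_one]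
    exact ENNReal.inv_mul_cancel (by simp) (by finiteness)⟩⟩

lemma toMeasure_empiricalMeasure (ω : ℕ → E) (n : ℕ) :
    (empiricalMeasure ω n : Measure E) =
      ((n : ℝ≥0∞) + 1)⁻¹ • ∑ i ∈ Finset.range (n + 1), Measure.dirac (ω i) := rfl

lemma coe_empiricalMeasure_apply (ω : ℕ → E) (n : ℕ) {s : Set E} (hs : MeasurableSet s) :
    ((empiricalMeasure ω n s : ℝ≥0) : ℝ) =
      (∑ i ∈ Finset.range (n + 1), s.indicator (fun _ => (1 : ℝ)) (ω i)) / ((n + 1 : ℕ) : ℝ) := by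
  have h : ((empiricalMeasure ω n s : ℝ≥0) : ℝ) = (empiricalMeasure ω n : Measure E).real s := by
    simp
  have hsum : (∑ i ∈ Finset.range (n + 1), s.indicator (1 : E → ℝ≥0∞) (ω i)).toReal =
      ∑ i ∈ Finset.range (n + 1), s.indicator (fun _ => (1 : ℝ)) (ω i) := by
    rw [ENNReal.toReal_sum]
    · refine Finset.sum_congr rfl fun i _ => ?_
      by_cases hi : ω i ∈ s <;> simp [hi]
    · intro i _
      by_cases hi : ω i ∈ s <;> simp [hi]
  rw [h, toMeasure_empiricalMeasure, Measure.real, Measure.smul_apply, Measure.finsetSum_apply]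
  simp_rw [Measure.dirac_apply' _ hs]
  rw [smul_eq_mul, ENNReal.toReal_mul, hsum, ENNReal.toReal_inv, div_eq_inv_mul]
  congr 2
  rw [← Nat.cast_succ, ENNReal.toReal_natCast]

/-- **Varadarajan's theorem**: the empirical measures of an i.i.d. sequence converge weakly almost
surely. -/
lemma ae_tendsto_empiricalMeasure [TopologicalSpace E] [SecondCountableTopology E]
    [OpensMeasurableSpace E] (P : ProbabilityMeasure E) :
    ∀ᵐ ω ∂(Measure.infinitePi fun _ : ℕ => (P : Measure E)),
      Tendsto (empiricalMeasure ω) atTop (𝓝 P) := by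
  let B : Finset (countableBasis E) → Set E := fun t => ⋂ s ∈ t, (s : Set E)
  have hBo : ∀ t, IsOpen (B t) := fun t =>
    isOpen_biInter_finset fun s _ => isOpen_of_mem_countableBasis s.2
  have hcount : Countable (countableBasis E) := (countable_countableBasis E).to_subtype
  have hlaw : ∀ᵐ ω ∂(Measure.infinitePi fun _ : ℕ => (P : Measure E)),
      ∀ t, Tendsto (fun n : ℕ => (∑ i ∈ Finset.range n,
        (B t).indicator (fun _ => (1 : ℝ)) (ω i)) / n) atTop
        (𝓝 (∫ x, (B t).indicator (fun _ => (1 : ℝ)) x ∂(P : Measure E))) :=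
    ae_all_iff.2 fun t => ae_tendsto_average_infinitePi (P : Measure E)
      ((integrable_const (1 : ℝ)).indicator (hBo t).measurableSet)
  filter_upwards [hlaw] with ω hω
  refine IsPiSystem.tendsto_probabilityMeasure_of_tendsto_of_mem (S := Set.range B) ?_ ?_ ?_ ?_
  · classical
    rintro _ ⟨s, rfl⟩ _ ⟨t, rfl⟩ -
    exact ⟨s ∪ t, Finset.iInf_union (s := s) (t := t) (f := fun s : countableBasis E => (s : Set E))⟩
  · rintro _ ⟨t, rfl⟩
    exact (hBo t).measurableSet
  · intro u hu x hx
    obtain ⟨s, hs, hxs, hsu⟩ := (isBasis_countableBasis E).exists_subset_of_mem_open hx hu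
    have hBs : B {⟨s, hs⟩} = s :=
      Finset.iInf_singleton (⟨s, hs⟩ : countableBasis E) fun s => (s : Set E)
    exact ⟨s, ⟨{⟨s, hs⟩}, hBs⟩, (isOpen_of_mem_countableBasis hs).mem_nhds hxs, hsu⟩
  · rintro _ ⟨t, rfl⟩
    have h := (tendsto_add_atTop_iff_nat 1).2 (hω t)
    rw [integral_indicator_const _ (hBo t).measurableSet] at h
    rw [← NNReal.tendsto_coe]
    simp_rw [coe_empiricalMeasure_apply _ _ (hBo t).measurableSet]
    simpa using h

/-- Scaling each factor of a finite power of a measure. -/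
lemma pi_const_smul {n : ℕ} (c : ℝ≥0) (P : Measure E) [SigmaFinite P] :
    Measure.pi (fun _ : Fin n => c • P) = c ^ n • Measure.pi fun _ : Fin n => P := by
  refine Measure.pi_eq fun s _ => ?_
  rw [Measure.smul_apply, Measure.pi_pi]
  simp only [Measure.smul_apply, ENNReal.smul_def, smul_eq_mul, Finset.prod_mul_distrib,
    Finset.prod_const, Finset.card_univ, Fintype.card_fin, ENNReal.coe_pow]

/-- The first `n` coordinates of an i.i.d. sequence have the `n`-fold product law. -/
lemma map_infinitePi_fin (P : Measure E) [IsProbabilityMeasure P] (n : ℕ) :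
    (Measure.infinitePi fun _ : ℕ => P).map (fun ω (i : Fin n) => ω i) =
      Measure.pi fun _ : Fin n => P := by
  rw [Measure.map_infinitePi_infinitePi_of_inj (P := fun _ : ℕ => P) Fin.val_injective,
    Measure.infinitePi_eq_pi]

end LawOfLargeNumbers

lemma isClosed_KN (d N : ℕ) : IsClosed (KN d N) := by
  simp only [KN, Set.ofPred_forall]
  exact isClosed_iInter fun i => isClosed_le (by fun_prop) continuous_const

lemma isCompact_KN (d N : ℕ) : IsCompact (KN d N) := by
  have h : KN d N = (EuclideanSpace.equiv (Fin d) ℝ) ⁻¹'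
      (Set.univ.pi fun _ => Set.Icc (-(N : ℝ)) N) := by
    ext x
    simp only [KN, abs_le, Set.mem_preimage, Set.mem_univ_pi, Set.mem_Icc]
    rfl
  rw [h]
  exact (EuclideanSpace.equiv (Fin d) ℝ).toHomeomorph.isCompact_preimage.2
    (isCompact_univ_pi fun _ => isCompact_Icc)

lemma continuous_diracFM : Continuous (diracFM : Eu d → Md d) :=
  ProbabilityMeasure.toFiniteMeasure_continuous.comp continuous_diracProba

lemma continuous_empM (c : ℝ) (n : ℕ) : Continuous (empM c n : (Fin n → Eu d) → Md d) :=
  (continuous_finsetSum Finset.univ fun i _ =>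
    continuous_diracFM.comp (continuous_apply i)).const_smul (c / (n : ℝ)).toNNReal

lemma toMeasure_empM (c : ℝ) (n : ℕ) (x : Fin n → Eu d) :
    (empM c n x : Measure (Eu d)) =
      (c / n).toNNReal • ∑ i, Measure.dirac (x i) := by
  rw [empM, FiniteMeasure.toMeasure_smul, FiniteMeasure.toMeasure_sum]
  rfl

lemma mass_empM {c : ℝ} (hc : 0 ≤ c) {n : ℕ} (hn : n ≠ 0) (x : Fin n → Eu d) :
    ((empM c n x).mass : ℝ) = c := by
  have h : ((empM c n x).mass : ℝ) = (empM c n x : Measure (Eu d)).real univ := rfl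
  rw [h, toMeasure_empM, measureReal_nnreal_smul_apply, Measure.real, Measure.finsetSum_apply]
  simp only [measure_univ, Finset.sum_const, Finset.card_univ, Fintype.card_fin, nsmul_eq_mul,
    mul_one, ENNReal.toReal_natCast]
  rw [Real.coe_toNNReal _ (by positivity)]
  field_simp

lemma empM_mem_HNk {N : ℕ} {k : ℝ} {μ : Md d} (hμ : μ ∈ HNk d N k) {n : ℕ} (hn : n ≠ 0)
    {x : Fin n → Eu d} (hx : ∀ i, x i ∈ KN d N) : empM (μ.mass : ℝ) n x ∈ HNk d N k := by
  refine ⟨?_, ?_⟩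
  · rw [toMeasure_empM, Measure.smul_apply, Measure.finsetSum_apply]
    simp [Measure.dirac_apply' _ (isClosed_KN d N).measurableSet.compl, hx]
  · have h := mass_empM μ.mass.2 hn x
    exact ⟨hμ.2.1.trans_eq h.symm, h.le.trans hμ.2.2⟩

lemma empM_eq_smul_empiricalMeasure (c : ℝ≥0) (ω : ℕ → Eu d) (n : ℕ) :
    empM (c : ℝ) (n + 1) (fun i => ω i) = c • (empiricalMeasure ω n).toFiniteMeasure := by
  apply Subtype.ext
  change (empM (c : ℝ) (n + 1) (fun i => ω i) : Measure (Eu d)) =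
    c • (empiricalMeasure ω n : Measure (Eu d))
  rw [toMeasure_empM, toMeasure_empiricalMeasure,
    Fin.sum_univ_eq_sum_range (fun i => Measure.dirac (ω i)) (n + 1)]
  have h : (((c : ℝ) / ((n + 1 : ℕ) : ℝ)).toNNReal : ℝ≥0∞) = c * ((n : ℝ≥0∞) + 1)⁻¹ := by
    have h1 : (c : ℝ) / ((n + 1 : ℕ) : ℝ) = ((c / ((n + 1 : ℕ) : ℝ≥0) : ℝ≥0) : ℝ) := by
      push_cast
      rfl
    rw [h1, Real.toNNReal_coe, ENNReal.coe_div (by positivity), div_eq_mul_inv]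
    push_cast
    rfl
  ext s hs
  simp only [Measure.smul_apply, ENNReal.smul_def, smul_eq_mul]
  rw [h, mul_assoc]

/-- If `f` is jointly continuous on `s ×ˢ K` with `K` compact, measures `m n ∈ s` tend to `q` and
the points `ω i` lie in `K`, then averages of `f (m n)` along `ω` have the same limit as averages
of `f q`. -/
lemma tendsto_average_of_continuousOn {α β : Type*} [TopologicalSpace α] [TopologicalSpace β]
    {f : α → β → ℝ} {s : Set α} {K : Set β} (hK : IsCompact K)
    (hf : ContinuousOn f.uncurry (s ×ˢ K)) {q : α} (hq : q ∈ s) {m : ℕ → α}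
    (hms : ∀ n, m n ∈ s) (hm : Tendsto m atTop (𝓝 q)) {ω : ℕ → β} (hω : ∀ i, ω i ∈ K) {L : ℝ}
    (hL : Tendsto (fun n : ℕ => (∑ i ∈ Finset.range (n + 1), f q (ω i)) / ((n + 1 : ℕ) : ℝ))
      atTop (𝓝 L)) :
    Tendsto (fun n : ℕ => (∑ i ∈ Finset.range (n + 1), f (m n) (ω i)) / ((n + 1 : ℕ) : ℝ))
      atTop (𝓝 L) := by
  have hdiff : Tendsto (fun n : ℕ =>
      (∑ i ∈ Finset.range (n + 1), f (m n) (ω i)) / ((n + 1 : ℕ) : ℝ) -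
        (∑ i ∈ Finset.range (n + 1), f q (ω i)) / ((n + 1 : ℕ) : ℝ)) atTop (𝓝 0) := by
    rw [Metric.tendsto_nhds]
    intro ε hε
    obtain ⟨V, hV, hVf⟩ := hK.mem_uniformity_of_prod hf hq (Metric.dist_mem_uniformity (half_pos hε))
    filter_upwards [tendsto_nhdsWithin_iff.2 ⟨hm, Eventually.of_forall hms⟩ hV] with n hn
    have hn' : m n ∈ V := hn
    rw [dist_zero_right, ← sub_div, ← Finset.sum_sub_distrib, norm_div, Real.norm_natCast]
    have hb : ‖∑ i ∈ Finset.range (n + 1), (f (m n) (ω i) - f q (ω i))‖ ≤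
        ((n + 1 : ℕ) : ℝ) * (ε / 2) := by
      refine (norm_sum_le_of_le _ fun i _ => (hVf _ hn' _ (hω i)).le).trans ?_
      simp
    have hpos : (0 : ℝ) < ((n + 1 : ℕ) : ℝ) := by positivity
    calc _ ≤ ε / 2 := by rwa [div_le_iff₀ hpos, mul_comm]
      _ < ε := half_lt_self hε
  simpa using hdiff.add hL

/-- the law-of-large-numbers step in the empirical approximation. Fix
`N ≥ 1`, `k > 1` and let `H = H_N^k`, `K = K_N`. If `v : H × K_N → ℝ` is bounded and
jointly continuous (weak topology on `H`), then for every `μ ∈ H`,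
`μ(ℝ^d)^{−n} ∫ (1/n) Σⱼ v((μ(ℝ^d)/n) Σᵢ δ_{xᵢ}, xⱼ) dμ^{⊗n} → μ(ℝ^d)^{−1} ∫ v(μ,x) dμ(x)`
as `n → ∞`. -/
theorem stmt16 (N : ℕ) (hN : 1 ≤ N) (k : ℝ) (hk : 1 < k)
    (v : Md d → Eu d → ℝ) (C : ℝ)
    (hvb : ∀ μ ∈ HNk d N k, ∀ x ∈ KN d N, |v μ x| ≤ C)
    (hvc : ContinuousOn (fun p : Md d × Eu d => v p.1 p.2) (HNk d N k ×ˢ KN d N)) :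
    ∀ μ ∈ HNk d N k,
      Filter.Tendsto
        (fun n : ℕ =>
          (((μ.mass : ℝ)) ^ n)⁻¹ *
            ∫ x : Fin n → Eu d,
              (1 / (n : ℝ)) * ∑ j : Fin n, v (empM (μ.mass : ℝ) n x) (x j)
              ∂(Measure.pi fun _ : Fin n => (μ : Measure (Eu d))))
        Filter.atTop
        (nhds ((μ.mass : ℝ)⁻¹ * ∫ x, v μ x ∂(μ : Measure (Eu d)))) := by
  intro μ hμ
  have hm0 : 0 < (μ.mass : ℝ) := (by positivity : 0 < 1 / k).trans_le hμ.2.1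
  have hmne : μ.mass ≠ 0 := fun h => by simp [h] at hm0
  set P : ProbabilityMeasure (Eu d) := μ.normalize
  have hμP' : μ = μ.mass • P.toFiniteMeasure := μ.self_eq_mass_smul_normalize
  have hμP : (μ : Measure (Eu d)) = μ.mass • (P : Measure (Eu d)) :=
    congrArg FiniteMeasure.toMeasure hμP'
  have hPK : ∀ᵐ x ∂(P : Measure (Eu d)), x ∈ KN d N := by
    have h := hμ.1
    rw [hμP, Measure.smul_apply, ENNReal.smul_def, smul_eq_mul, mul_eq_zero] at h
    exact h.resolve_left (ENNReal.coe_ne_zero.2 hmne)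
  have hrestrict : (P : Measure (Eu d)).restrict (KN d N) = P :=
    Measure.restrict_eq_self_of_ae_mem hPK
  have hvμ : ContinuousOn (v μ) (KN d N) :=
    hvc.comp (f := fun x => (μ, x)) (by fun_prop) fun x hx => ⟨hμ, hx⟩
  have hvμP : Integrable (v μ) (P : Measure (Eu d)) := by
    have h := hvμ.integrableOn_compact (μ := (P : Measure (Eu d))) (isCompact_KN d N)
    rwa [IntegrableOn, hrestrict] at h
  set Q : Measure (ℕ → Eu d) := Measure.infinitePi fun _ : ℕ => (P : Measure (Eu d))
  have hQK : ∀ᵐ ω ∂Q, ∀ i, ω i ∈ KN d N := ae_all_iff.2 fun i =>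
    (measurePreserving_eval_infinitePi
      (fun _ : ℕ => (P : Measure (Eu d))) i).quasiMeasurePreserving.ae hPK
  let F : (n : ℕ) → (Fin n → Eu d) → ℝ := fun n x =>
    (1 / (n : ℝ)) * ∑ j : Fin n, v (empM (μ.mass : ℝ) n x) (x j)
  have hFmeas : ∀ n : ℕ, n ≠ 0 →
      AEStronglyMeasurable (F n) (Measure.pi fun _ : Fin n => (P : Measure (Eu d))) := by
    intro n hn
    have hcont : ContinuousOn (F n) (Set.univ.pi fun _ => KN d N) := by
      refine continuousOn_const.mul (continuousOn_finsetSum _ fun j _ => ?_)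
      refine hvc.comp (f := fun x : Fin n → Eu d => (empM (μ.mass : ℝ) n x, x j))
        ((continuous_empM _ n).prodMk (continuous_apply j)).continuousOn fun x hx => ?_
      exact ⟨empM_mem_HNk hμ hn fun i => hx i trivial, hx j trivial⟩
    have h := hcont.aestronglyMeasurable
      (μ := Measure.pi fun _ : Fin n => (P : Measure (Eu d)))
      (MeasurableSet.univ_pi fun _ => (isClosed_KN d N).measurableSet)
    rwa [Measure.restrict_pi_pi, hrestrict] at h
  have hproj : ∀ n : ℕ, Measurable fun (ω : ℕ → Eu d) (i : Fin n) => ω i := fun n => by fun_prop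
  have hleft : ∀ n : ℕ, n ≠ 0 →
      (((μ.mass : ℝ)) ^ n)⁻¹ * ∫ x, F n x ∂(Measure.pi fun _ : Fin n => (μ : Measure (Eu d))) =
        ∫ ω, F n (fun i => ω i) ∂Q := by
    intro n hn
    rw [hμP, pi_const_smul, integral_smul_nnreal_measure, NNReal.smul_def, smul_eq_mul,
      NNReal.coe_pow, inv_mul_cancel_left₀ (pow_ne_zero _ hm0.ne'),
      ← map_infinitePi_fin, integral_map (hproj n).aemeasurable]
    rw [map_infinitePi_fin]
    exact hFmeas n hn
  have hright : (μ.mass : ℝ)⁻¹ * ∫ x, v μ x ∂(μ : Measure (Eu d)) =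
      ∫ _ω, (∫ x, v μ x ∂(P : Measure (Eu d))) ∂Q := by
    have h : ∫ x, v μ x ∂(μ : Measure (Eu d)) =
        (μ.mass : ℝ) * ∫ x, v μ x ∂(P : Measure (Eu d)) := by
      conv_lhs => rw [hμP]
      rw [integral_smul_nnreal_measure, NNReal.smul_def, smul_eq_mul]
    rw [h, inv_mul_cancel_left₀ hm0.ne']
    simp
  rw [← tendsto_add_atTop_iff_nat 1, hright]
  refine Tendsto.congr (fun n => (hleft (n + 1) n.succ_ne_zero).symm) ?_
  refine tendsto_integral_of_dominated_convergence (fun _ => C) (fun n => ?_)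
    (integrable_const C) (fun n => ?_) ?_
  · refine AEStronglyMeasurable.comp_aemeasurable (g := F (n + 1))
      (f := fun (ω : ℕ → Eu d) (i : Fin (n + 1)) => ω i)
      ?_ (hproj (n + 1)).aemeasurable
    rw [map_infinitePi_fin]
    exact hFmeas (n + 1) n.succ_ne_zero
  · filter_upwards [hQK] with ω hω
    have hpos : (0 : ℝ) < ((n + 1 : ℕ) : ℝ) := by positivity
    have hsum : ‖∑ j : Fin (n + 1), v (empM (μ.mass : ℝ) (n + 1) fun i => ω i) (ω j)‖ ≤
        ((n + 1 : ℕ) : ℝ) * C := by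
      refine (norm_sum_le_of_le (n := fun _ => C) _ fun j _ => ?_).trans (by simp)
      exact hvb _ (empM_mem_HNk hμ n.succ_ne_zero fun i => hω i) _ (hω j)
    rw [norm_mul, norm_div, norm_one, Real.norm_natCast, one_div, inv_mul_le_iff₀ hpos]
    exact hsum
  · filter_upwards [hQK, ae_tendsto_empiricalMeasure P,
      ae_tendsto_average_infinitePi (P : Measure (Eu d)) hvμP] with ω hω hemp hlaw
    have hm : Tendsto (fun n : ℕ => empM (μ.mass : ℝ) (n + 1) fun i => ω i) atTop (𝓝 μ) := by
      simp_rw [empM_eq_smul_empiricalMeasure]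
      conv => rhs; rw [hμP']
      exact ((ProbabilityMeasure.tendsto_nhds_iff_toFiniteMeasure_tendsto_nhds _).1 hemp).const_smul
        μ.mass
    have h := tendsto_average_of_continuousOn (isCompact_KN d N) (f := v) hvc hμ
      (fun n => empM_mem_HNk hμ n.succ_ne_zero fun i => hω i) hm hω
      ((tendsto_add_atTop_iff_nat 1).2 hlaw)
    refine h.congr fun n => ?_
    rw [← Fin.sum_univ_eq_sum_range
      (fun i => v (empM (μ.mass : ℝ) (n + 1) fun i => ω i) (ω i)) (n + 1)]
    simp only [F]
    rw [one_div, div_eq_inv_mul]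

end
end
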